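/- Let K be a field of arbitrary characteristic, A a central line arrangement in K², and let m, m' be multiplicities on A with m(H) ≥ m'(H) for every H ∈ A. Put exp(A,m') = (d₁,d₂) and exp(A,m) = (e₁,e₂) with d₁ ≤ d₂ and e₁ ≤ e₂. Then d₁ ≤ e₁ and d₂ ≤ e₂. -/

import Mathlib

open MvPolynomial

variable {K : Type*} [Field K]

/-- A subset of `K × K` is a line through the origin. -/
def IsCentralLine (L : Set (K × K)) : Prop :=
  ∃ a b : K, (a, b) ≠ (0, 0) ∧ L = {p : K × K | a * p.1 + b * p.2 = 0}

/-- A central line arrangement: a finite set of lines through the origin of `K²`. -/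
def IsCentralArr (A : Finset (Set (K × K))) : Prop :=
  ∀ L ∈ A, IsCentralLine L

/-- The linear form `a·x + b·y` in `K[x,y]`. -/
noncomputable def lin2 (a b : K) : MvPolynomial (Fin 2) K :=
  C a * X 0 + C b * X 1

/-- The action on `f` of the derivation with coefficient vector `θ`. -/
noncomputable def applyDer2 (θ : Fin 2 → MvPolynomial (Fin 2) K)
    (f : MvPolynomial (Fin 2) K) : MvPolynomial (Fin 2) K :=
  ∑ i, θ i * pderiv i f

/-- `θ` belongs to `D(A,m)`, the logarithmic derivation module of the multiarrangement
`(A, m)`: `θ(α_H) ∈ S'·α_H^{m(H)}` for every `H ∈ A`. -/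
def InDm (A : Finset (Set (K × K))) (m : Set (K × K) → ℕ)
    (θ : Fin 2 → MvPolynomial (Fin 2) K) : Prop :=
  ∀ L ∈ A, ∀ a b : K, (a, b) ≠ (0, 0) →
    L = {p : K × K | a * p.1 + b * p.2 = 0} →
    ∃ g, applyDer2 θ (lin2 a b) = g * lin2 a b ^ m L

/-- A homogeneous derivation of degree `d` on `K[x,y]`. -/
def HomogDer2 (θ : Fin 2 → MvPolynomial (Fin 2) K) (d : ℕ) : Prop :=
  ∀ i, (θ i).IsHomogeneous d

/-- `exp(A,m) = (d₁,d₂)`: the free module `D(A,m)` has a homogeneous basis with degrees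
`d₁` and `d₂`. -/
def IsExpPair (A : Finset (Set (K × K))) (m : Set (K × K) → ℕ) (d₁ d₂ : ℕ) : Prop :=
  ∃ θ₁ θ₂ : Fin 2 → MvPolynomial (Fin 2) K,
    InDm A m θ₁ ∧ InDm A m θ₂ ∧ HomogDer2 θ₁ d₁ ∧ HomogDer2 θ₂ d₂ ∧
    ∀ θ : Fin 2 → MvPolynomial (Fin 2) K, InDm A m θ →
      ∃! cfs : MvPolynomial (Fin 2) K × MvPolynomial (Fin 2) K,
        θ = fun j => cfs.1 * θ₁ j + cfs.2 * θ₂ j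

/-- `|m| = ∑_{H ∈ A} m(H)`. -/
def msize (A : Finset (Set (K × K))) (m : Set (K × K) → ℕ) : ℕ := ∑ H ∈ A, m H

section HomogeneousComponent

attribute [local instance] MvPolynomial.gradedAlgebra

theorem MvPolynomial.homogeneousComponent_mul_of_isHomogeneous_of_lt {σ R : Type*}
    [CommSemiring R] {p : MvPolynomial σ R} {d n : ℕ} (hp : p.IsHomogeneous d) (h : n < d)
    (a : MvPolynomial σ R) : homogeneousComponent n (a * p) = 0 := by
  have := DirectSum.coe_decompose_mul_of_right_mem_of_not_le (homogeneousSubmodule σ R)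
    (a := a) (n := n) ((mem_homogeneousSubmodule d p).2 hp) h.not_ge
  simp only [← decomposition.decompose'_apply]
  exact this

theorem MvPolynomial.homogeneousComponent_mul_of_isHomogeneous_of_le {σ R : Type*}
    [CommSemiring R] {p : MvPolynomial σ R} {d n : ℕ} (hp : p.IsHomogeneous d) (h : d ≤ n)
    (a : MvPolynomial σ R) :
    homogeneousComponent n (a * p) = homogeneousComponent (n - d) a * p := by
  have := DirectSum.coe_decompose_mul_of_right_mem_of_le (homogeneousSubmodule σ R)
    (a := a) (n := n) ((mem_homogeneousSubmodule d p).2 hp) h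
  simp only [← decomposition.decompose'_apply]
  exact this

end HomogeneousComponent

theorem InDm.zero (A : Finset (Set (K × K))) (m : Set (K × K) → ℕ) : InDm A m 0 :=
  fun _ _ _ _ _ _ => ⟨0, by simp [applyDer2]⟩

theorem InDm.mono {A : Finset (Set (K × K))} {m m' : Set (K × K) → ℕ}
    (hle : ∀ H ∈ A, m' H ≤ m H) {θ : Fin 2 → MvPolynomial (Fin 2) K} (h : InDm A m θ) :
    InDm A m' θ := by
  intro L hL a b hab hLab
  obtain ⟨g, hg⟩ := h L hL a b hab hLab
  refine ⟨g * lin2 a b ^ (m L - m' L), ?_⟩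
  rw [hg, mul_assoc, ← pow_add, Nat.sub_add_cancel (hle L hL)]

/-- A homogeneous combination of two homogeneous derivations involves only a multiple of the
first one if its degree is smaller than that of the second one. -/
theorem HomogDer2.eq_mul_of_lt {η θ₁ θ₂ : Fin 2 → MvPolynomial (Fin 2) K} {e d₁ d₂ : ℕ}
    (hη : HomogDer2 η e) (hθ₁ : HomogDer2 θ₁ d₁) (hθ₂ : HomogDer2 θ₂ d₂)
    {a b : MvPolynomial (Fin 2) K} (h : η = fun j => a * θ₁ j + b * θ₂ j) (hlt : e < d₂) :
    ∃ c, (∀ j, η j = c * θ₁ j) ∧ (e < d₁ → c = 0) := by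
  have key (j : Fin 2) : η j = homogeneousComponent e (a * θ₁ j) := by
    rw [← homogeneousComponent_eq_self (hη j), congrFun h j, map_add,
      homogeneousComponent_mul_of_isHomogeneous_of_lt (hθ₂ j) hlt, add_zero]
  rcases lt_or_ge e d₁ with h₁ | h₁
  · refine ⟨0, fun j => ?_, fun _ => rfl⟩
    rw [key, homogeneousComponent_mul_of_isHomogeneous_of_lt (hθ₁ j) h₁, zero_mul]
  · refine ⟨homogeneousComponent (e - d₁) a, fun j => ?_, fun h₂ => absurd h₁ h₂.not_ge⟩
    rw [key, homogeneousComponent_mul_of_isHomogeneous_of_le (hθ₁ j) h₁]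

/-- **Lemma 2.9**. Let `A` be a central line arrangement and `m ≥ m'` multiplicities on `A`
with `exp(A,m') = (d₁,d₂)`, `exp(A,m) = (e₁,e₂)`, `d₁ ≤ d₂`, `e₁ ≤ e₂`. Then `d₁ ≤ e₁`
and `d₂ ≤ e₂`. -/
theorem exponents_monotone_in_multiplicity
    {K : Type*} [Field K] (A : Finset (Set (K × K))) (hA : IsCentralArr A)
    (m m' : Set (K × K) → ℕ) (hm' : ∀ H ∈ A, 1 ≤ m' H)
    (hle : ∀ H ∈ A, m' H ≤ m H)
    (d₁ d₂ : ℕ) (hd : d₁ ≤ d₂) (hexp' : IsExpPair A m' d₁ d₂)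
    (e₁ e₂ : ℕ) (he : e₁ ≤ e₂) (hexp : IsExpPair A m e₁ e₂) :
    d₁ ≤ e₁ ∧ d₂ ≤ e₂ := by
  obtain ⟨θ₁, θ₂, -, -, hθ₁, hθ₂, hspan⟩ := hexp'
  obtain ⟨η₁, η₂, hDη₁, hDη₂, hη₁, hη₂, hbasis⟩ := hexp
  have indep (a b : MvPolynomial (Fin 2) K) (h : ∀ j, a * η₁ j + b * η₂ j = 0) :
      a = 0 ∧ b = 0 := by
    have := (hbasis 0 (InDm.zero A m)).unique (y₁ := (a, b)) (y₂ := (0, 0))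
      (funext fun j => (h j).symm) (funext fun j => by simp)
    exact Prod.mk.inj this
  obtain ⟨⟨a₁, b₁⟩, h₁, -⟩ := hspan η₁ (hDη₁.mono hle)
  obtain ⟨⟨a₂, b₂⟩, h₂, -⟩ := hspan η₂ (hDη₂.mono hle)
  constructor
  · by_contra! hlt
    obtain ⟨c, hc, hc0⟩ := hη₁.eq_mul_of_lt hθ₁ hθ₂ h₁ (hlt.trans_le hd)
    exact one_ne_zero (indep 1 0 fun j => by simp [hc, hc0 hlt]).1
  · by_contra! hlt
    obtain ⟨c₁, hc₁, -⟩ := hη₁.eq_mul_of_lt hθ₁ hθ₂ h₁ (he.trans_lt hlt)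
    obtain ⟨c₂, hc₂, -⟩ := hη₂.eq_mul_of_lt hθ₁ hθ₂ h₂ hlt
    have hc₁0 : c₁ = 0 :=
      neg_eq_zero.1 (indep c₂ (-c₁) fun j => by rw [hc₁, hc₂]; ring).2
    exact one_ne_zero (indep 1 0 fun j => by simp [hc₁, hc₁0]).1
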